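/- Let φ be the Lennard-Jones potential φ(r) = r^{−12} − 2r^{−6}, set r_L = 0.9706, r_U = 1.0771, and Ω = (r_L, r_U)^{2N+1}. Suppose the external forces f_j are anti-symmetric and −2.56 < Φ_j < 2.56 for all j = −N,…,N. Then for every symmetric rⁿ ∈ Ω there is a unique symmetric rⁿ⁺¹ ∈ Ω with Ψ̂^E(rⁿ⁺¹) + Ψ̂^G(rⁿ) = Φ, and the induced ghost-force iteration map is a contraction with constant at most 1/2 in the maximum norm; in particular, ‖rⁿ⁺¹ − r‖_∞ ≤ (1/2)‖rⁿ − r‖_∞, where r is the unique symmetric solution in Ω of F^{QCF}_j(r) + f_j = 0 for j = −N,…,N+1. -/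

import Mathlib

open Finset Set

noncomputable section

/-- The `j`-th component (for `j ∈ [-N, N]`) of a vector in `ℝ^{2N+1}`. -/
def vcomp (N : ℕ) (r : Fin (2*N+1) → ℝ) (j : ℤ) : ℝ :=
  if h : (j + N).toNat < 2*N+1 then r ⟨(j + N).toNat, h⟩ else 0

/-- `η̂(r) = η(r) + 2 η(2r)`, the derivative of the energy density. -/
def etaHat (η : ℝ → ℝ) : ℝ → ℝ := fun r => η r + 2 * η (2*r)

/-- Structural assumptions on the atomistic potential (with `η = φ'`). -/
def Assump (η : ℝ → ℝ) (r1 r2 a0 a1 : ℝ) : Prop :=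
  0 < a0 ∧ a0 < r1 ∧ r1 < r2 ∧ r2 < 2*a0 ∧ a0 < a1 ∧
  (∀ r ∈ Ioo (0:ℝ) r1, 0 < deriv η r) ∧ (∀ r ∈ Ioi r1, deriv η r < 0) ∧
  (∀ r ∈ Ioo (0:ℝ) r2, deriv (deriv η) r < 0) ∧ (∀ r ∈ Ioi r2, 0 < deriv (deriv η) r) ∧
  (∀ r ∈ Ioo (0:ℝ) a0, etaHat η r < 0) ∧ (∀ r ∈ Ioi a0, 0 < etaHat η r) ∧
  (∀ r ∈ Ioo (0:ℝ) a1, 0 < deriv (etaHat η) r) ∧ (∀ r ∈ Ioi a1, deriv (etaHat η) r < 0)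

/-- The symmetrized force-based quasicontinuum conjugate-force map `Ψ̂^F`. -/
def PsiF (N K : ℕ) (η : ℝ → ℝ) (r : Fin (2*N+1) → ℝ) : Fin (2*N+1) → ℝ := fun i =>
  let j : ℤ := (i.val : ℤ) - (N : ℤ)
  let c := vcomp N r
  if -(K:ℤ)+1 ≤ j ∧ j ≤ (K:ℤ)-1 then
    η (c j) + η (c j + c (j-1)) + η (c j + c (j+1))
      + 2 * η (2 * c (K:ℤ)) - η (c (K:ℤ) + c ((K:ℤ)-1)) - η (c (K:ℤ) + c ((K:ℤ)+1))
  else η (c j) + 2 * η (2 * c j)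

/-- The symmetrized energy-based quasicontinuum conjugate-force map `Ψ̂^E`. -/
def PsiE (N K : ℕ) (η : ℝ → ℝ) (r : Fin (2*N+1) → ℝ) : Fin (2*N+1) → ℝ := fun i =>
  let j : ℤ := (i.val : ℤ) - (N : ℤ)
  let c := vcomp N r
  if j = -(K:ℤ)-1 then η (c j) + 2*η (2*c j) + (1/2)*η (c j + c (j+1))
  else if j = (K:ℤ)+1 then η (c j) + 2*η (2*c j) + (1/2)*η (c (j-1) + c j)
  else if j = -(K:ℤ) ∨ j = (K:ℤ) then
    η (c j) + η (2*c j) + (1/2)*η (c j + c (j-1)) + (1/2)*η (c j + c (j+1))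
  else if j = -(K:ℤ)+1 then η (c j) + (1/2)*η (c j + c (j-1)) + η (c j + c (j+1))
  else if j = (K:ℤ)-1 then η (c j) + η (c j + c (j-1)) + (1/2)*η (c j + c (j+1))
  else if -(K:ℤ)+2 ≤ j ∧ j ≤ (K:ℤ)-2 then η (c j) + η (c j + c (j-1)) + η (c j + c (j+1))
  else η (c j) + 2*η (2*c j)

/-- The ghost-force correction map `Ψ̂^G = Ψ̂^F - Ψ̂^E`. -/
def PsiG (N K : ℕ) (η : ℝ → ℝ) (r : Fin (2*N+1) → ℝ) : Fin (2*N+1) → ℝ :=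
  fun i => PsiF N K η r i - PsiE N K η r i

/-- The force-based quasicontinuum forces, with `r` given as a `ℤ`-indexed family. -/
def FQCFr (N K : ℕ) (η : ℝ → ℝ) (r : ℤ → ℝ) (j : ℤ) : ℝ :=
  if j = -(N:ℤ) then η (r j) + 2*η (2*r j)
  else if j = (N:ℤ)+1 then -(η (r (j-1)) + 2*η (2*r (j-1)))
  else if -(K:ℤ)+1 ≤ j ∧ j ≤ (K:ℤ) then
    (η (r j) + η (r j + r (j+1))) - (η (r (j-1)) + η (r (j-1) + r (j-2)))
  else (η (r j) + 2*η (2*r j)) - (η (r (j-1)) + 2*η (2*r (j-1)))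

/-- The Jacobian matrix of `Ψ̂^F`. -/
def Jac (N K : ℕ) (η : ℝ → ℝ) (r : Fin (2*N+1) → ℝ) :
    Matrix (Fin (2*N+1)) (Fin (2*N+1)) ℝ :=
  fun i j => deriv (fun t => PsiF N K η (Function.update r j t) i) (r j)

/-- Strict diagonal dominance with positive diagonal. -/
def SDD {m : ℕ} (A : Matrix (Fin m) (Fin m) ℝ) : Prop :=
  ∀ i, 0 < A i i ∧ ∑ j ∈ Finset.univ.erase i, |A i j| < A i i

/-- A vector `r ∈ ℝ^{2N+1}` is symmetric if `r_{-j} = r_j` for `1 ≤ j ≤ N`. -/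
def SymVec (N : ℕ) (r : Fin (2*N+1) → ℝ) : Prop :=
  ∀ j : ℤ, 1 ≤ j → j ≤ (N:ℤ) → vcomp N r (-j) = vcomp N r j


/-- A map on a box that points outward at the faces and whose increments are, componentwise, a
positive multiple of the diagonal increment up to a smaller off-diagonal error has a zero in the
open box; if it respects the relabelling `σ`, the zero can be chosen invariant under `σ`. -/
theorem exists_invariant_zero_of_diagonally_dominant {n : ℕ} (σ : Fin n → Fin n)
    (P : (Fin n → ℝ) → Fin n → ℝ) {a b α A β : ℝ} (hab : a ≤ b) (hβ : 0 ≤ β) (hβα : β < α)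
    (hαA : α ≤ A)
    (hP : ∀ r s : Fin n → ℝ, (∀ k, r k ∈ Set.Icc a b) → (∀ k, s k ∈ Set.Icc a b) →
      ∀ L, (∀ k, |r k - s k| ≤ L) →
      ∀ i, ∃ t, α ≤ t ∧ t ≤ A ∧ |P r i - P s i - t * (r i - s i)| ≤ β * L)
    (hlo : ∀ r : Fin n → ℝ, (∀ k, r k ∈ Set.Icc a b) → ∀ i, r i = a → P r i < 0)
    (hhi : ∀ r : Fin n → ℝ, (∀ k, r k ∈ Set.Icc a b) → ∀ i, r i = b → 0 < P r i)
    (hσ : ∀ r : Fin n → ℝ, (∀ k, r k ∈ Set.Icc a b) → (∀ k, r (σ k) = r k) →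
      ∀ k, P r (σ k) = P r k) :
    ∃ r : Fin n → ℝ, (∀ k, r k ∈ Set.Ioo a b) ∧ (∀ k, r (σ k) = r k) ∧ ∀ k, P r k = 0 := by
  have hAβ : 0 < A + β := by linarith
  obtain ⟨τ, hτ, hτA⟩ : ∃ τ : ℝ, 0 < τ ∧ τ * (A + β) = 1 :=
    ⟨1 / (A + β), by positivity, by field_simp⟩
  set T : (Fin n → ℝ) → Fin n → ℝ := fun r i => r i - τ * P r i with hT
  have hbox : ∀ r : Fin n → ℝ, (∀ k, r k ∈ Set.Icc a b) → ∀ i, T r i ∈ Set.Ioo a b := by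
    intro r hr i
    have hbd : ∀ c ∈ Set.Icc a b, ∀ k, Function.update r i c k ∈ Set.Icc a b := by
      intro c hc k
      rcases eq_or_ne k i with rfl | hk
      · simpa using hc
      · simpa [hk] using hr k
    have key : ∀ c ∈ Set.Icc a b, ∃ t, α ≤ t ∧ t ≤ A ∧
        |P r i - P (Function.update r i c) i - t * (r i - c)| ≤ β * |r i - c| := by
      intro c hc
      have := hP r _ hr (hbd c hc) |r i - c| (by
        intro k
        rcases eq_or_ne k i with rfl | hk
        · simp
        · simp [hk]) i
      simpa using this
    obtain ⟨h1, h2⟩ := hr i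
    constructor
    · obtain ⟨t, ht1, ht2, ht⟩ := key a ⟨le_rfl, hab⟩
      have hneg := hlo _ (hbd a ⟨le_rfl, hab⟩) i (by simp)
      rw [abs_of_nonneg (by linarith : 0 ≤ r i - a)] at ht
      have h3 := (abs_le.1 ht).2
      have h4 : t * (r i - a) ≤ A * (r i - a) := by gcongr
      have h5 : P r i < (A + β) * (r i - a) := by linarith
      have h6 : τ * P r i < τ * ((A + β) * (r i - a)) := by gcongr
      rw [← mul_assoc, hτA] at h6
      simp only [hT]; linarith
    · obtain ⟨t, ht1, ht2, ht⟩ := key b ⟨hab, le_rfl⟩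
      have hpos := hhi _ (hbd b ⟨hab, le_rfl⟩) i (by simp)
      rw [abs_of_nonpos (by linarith : r i - b ≤ 0)] at ht
      have h3 := (abs_le.1 ht).1
      have h4 : t * (b - r i) ≤ A * (b - r i) := by gcongr
      have h5 : -(A + β) * (b - r i) < P r i := by linarith
      have h6 : τ * (-(A + β) * (b - r i)) < τ * P r i := by gcongr
      have h7 : τ * (-(A + β) * (b - r i)) = -(b - r i) := by
        linear_combination (-(b - r i)) * hτA
      simp only [hT]; linarith
  set S : Set (Fin n → ℝ) := {r | (∀ k, r k ∈ Set.Icc a b) ∧ ∀ k, r (σ k) = r k} with hS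
  have hSc : IsClosed S := by
    have h1 : IsClosed {r : Fin n → ℝ | ∀ k, r k ∈ Set.Icc a b} := by
      simp only [Set.ofPred_forall]
      exact isClosed_iInter fun k => isClosed_Icc.preimage (continuous_apply k)
    have h2 : IsClosed {r : Fin n → ℝ | ∀ k, r (σ k) = r k} := by
      simp only [Set.ofPred_forall]
      exact isClosed_iInter fun k => isClosed_eq (continuous_apply _) (continuous_apply _)
    exact h1.inter h2
  have hmaps : Set.MapsTo T S S := by
    intro r hr
    refine ⟨fun k => Set.Ioo_subset_Icc_self (hbox r hr.1 k), fun k => ?_⟩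
    simp only [hT, hr.2 k, hσ r hr.1 hr.2 k]
  have hq0 : 0 ≤ 1 - τ * (α - β) := by nlinarith
  have hq1 : 1 - τ * (α - β) < 1 := by nlinarith
  have hcontr : ContractingWith ⟨1 - τ * (α - β), hq0⟩ (hmaps.restrict T S S) := by
    refine ⟨by exact_mod_cast hq1, LipschitzWith.of_dist_le_mul ?_⟩
    rintro ⟨r, hr⟩ ⟨s, hs⟩
    change dist (T r) (T s) ≤ (1 - τ * (α - β)) * dist r s
    refine (dist_pi_le_iff (by positivity)).2 fun i => ?_
    obtain ⟨t, ht1, ht2, ht⟩ := hP r s hr.1 hs.1 (dist r s)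
      (fun k => by simpa [Real.dist_eq] using dist_le_pi_dist r s k) i
    have hi : |r i - s i| ≤ dist r s := by simpa [Real.dist_eq] using dist_le_pi_dist r s i
    have hτt : 0 ≤ 1 - τ * t := by nlinarith
    rw [Real.dist_eq]
    calc |T r i - T s i|
        = |(1 - τ * t) * (r i - s i) - τ * (P r i - P s i - t * (r i - s i))| := by
          simp only [hT]; ring_nf
      _ ≤ |(1 - τ * t) * (r i - s i)| + |τ * (P r i - P s i - t * (r i - s i))| := abs_sub _ _
      _ = (1 - τ * t) * |r i - s i| + τ * |P r i - P s i - t * (r i - s i)| := by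
          rw [abs_mul, abs_mul, abs_of_nonneg hτt, abs_of_pos hτ]
      _ ≤ (1 - τ * t) * dist r s + τ * (β * dist r s) := by gcongr
      _ ≤ (1 - τ * α) * dist r s + τ * (β * dist r s) := by gcongr
      _ = _ := by ring
  obtain ⟨r, hr, hfix, -⟩ := ContractingWith.exists_fixedPoint' hSc.isComplete hmaps hcontr
    (x := fun _ => a) ⟨fun _ => ⟨le_rfl, hab⟩, fun _ => rfl⟩ (edist_ne_top _ _)
  have hfix' : ∀ k, T r k = r k := fun k => congrFun hfix k
  refine ⟨r, fun k => hfix' k ▸ hbox r hr.1 k, hr.2, fun k => ?_⟩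
  have := hfix' k
  simp only [hT, sub_eq_self, mul_eq_zero, hτ.ne', false_or] at this
  exact this

/-- Quantitative bounds on the pair force `η` near the nearest-neighbour distance and near twice
that distance. -/
structure PairForceBounds (η : ℝ → ℝ) (a b A : ℝ) : Prop where
  stiff : ∀ x ∈ Set.Icc a b, ∀ y ∈ Set.Icc a b,
    ∃ t, (8.7 : ℝ) ≤ t ∧ t ≤ A ∧ η x - η y = t * (x - y)
  soft : ∀ x ∈ Set.Icc (2 * a) (2 * b), ∀ y ∈ Set.Icc (2 * a) (2 * b),
    |η x - η y| ≤ 0.41 * |x - y|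
  anti : AntitoneOn η (Set.Icc (2 * a) (2 * b))
  lower : η a + 2 * η (2 * a) ≤ -2.65
  upper : 2.65 ≤ η b + 2 * η (2 * b)

theorem hasDerivAt_div_pow_sub_div_pow (c d : ℝ) (m n : ℕ) {x : ℝ} (hx : x ≠ 0) :
    HasDerivAt (fun y : ℝ => c / y ^ m - d / y ^ n)
      (d * n / x ^ (n + 1) - c * m / x ^ (m + 1)) x := by
  have h : ∀ (c : ℝ) (m : ℕ), HasDerivAt (fun y : ℝ => c / y ^ m) (-(c * m / x ^ (m + 1))) x := by
    intro c m
    have hfun : (fun y : ℝ => c / y ^ m) = fun y => c * y ^ (-(m : ℤ)) := by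
      funext y; simp [div_eq_mul_inv]
    rw [hfun]
    refine ((hasDerivAt_zpow (-(m : ℤ)) x (Or.inl hx)).const_mul c).congr_deriv ?_
    have : (-(m : ℤ) - 1) = -((m + 1 : ℕ) : ℤ) := by push_cast; ring
    rw [this, zpow_neg, zpow_natCast]; push_cast; ring
  exact ((h c m).sub (h d n)).congr_deriv (by ring)

theorem pairForceBounds_lennardJones :
    PairForceBounds (deriv fun r : ℝ => 1 / r ^ 12 - 2 / r ^ 6) 0.9706 1.0771 300 := by
  set η := deriv fun r : ℝ => 1 / r ^ 12 - 2 / r ^ 6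
  have hη : ∀ x : ℝ, 0 < x → η x = 12 / x ^ 7 - 12 / x ^ 13 := by
    intro x hx
    refine (hasDerivAt_div_pow_sub_div_pow 1 2 12 6 hx.ne').deriv.trans ?_
    norm_num
  have hη' : ∀ x : ℝ, 0 < x → HasDerivAt η (156 / x ^ 14 - 84 / x ^ 8) x := by
    intro x hx
    refine ((hasDerivAt_div_pow_sub_div_pow 12 12 7 13 hx.ne').congr_of_eventuallyEq ?_).congr_deriv
      (by norm_num)
    filter_upwards [lt_mem_nhds hx] with y hy using hη y hy
  have mvt : ∀ x y : ℝ, 0 < x → x < y →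
      ∃ z ∈ Set.Ioo x y, η y - η x = (156 / z ^ 14 - 84 / z ^ 8) * (y - x) := by
    intro x y hx hxy
    obtain ⟨z, hz, h⟩ := exists_hasDerivAt_eq_slope η _ hxy
      (fun u hu => (hη' u (hx.trans_le hu.1)).continuousAt.continuousWithinAt)
      (fun u hu => hη' u (hx.trans hu.1))
    refine ⟨z, hz, ?_⟩
    rw [h, div_mul_cancel₀ _ (sub_pos.2 hxy).ne']
  have stiff : ∀ z : ℝ, 0.9706 ≤ z → z ≤ 1.0771 →
      8.7 ≤ 156 / z ^ 14 - 84 / z ^ 8 ∧ 156 / z ^ 14 - 84 / z ^ 8 ≤ 300 := by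
    intro z h1 h2
    have hz : 0 < z := by linarith
    have h6 : z ^ 6 ≤ 1.0771 ^ 6 := by gcongr
    have h14 : z ^ 14 ≤ 1.0771 ^ 14 := by gcongr
    have l14 : (0.9706 : ℝ) ^ 14 ≤ z ^ 14 := by gcongr
    have e : 156 / z ^ 14 - 84 / z ^ 8 = (156 - 84 * z ^ 6) / z ^ 14 := by
      field_simp
    rw [e]
    constructor
    · rw [le_div_iff₀ (by positivity)]
      norm_num at h6 h14 ⊢
      linarith
    · rw [div_le_iff₀ (by positivity)]
      have : 0 < z ^ 6 := by positivity
      norm_num at l14 ⊢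
      linarith
  have soft : ∀ z : ℝ, 2 * 0.9706 ≤ z → z ≤ 2 * 1.0771 →
      -0.41 ≤ 156 / z ^ 14 - 84 / z ^ 8 ∧ 156 / z ^ 14 - 84 / z ^ 8 ≤ 0 := by
    intro z h1 h2
    have hz : 0 < z := by linarith
    have h6 : z ^ 6 ≤ (2 * 1.0771) ^ 6 := by gcongr
    have l6 : (2 * 0.9706 : ℝ) ^ 6 ≤ z ^ 6 := by gcongr
    have l8 : (2 * 0.9706 : ℝ) ^ 8 ≤ z ^ 8 := by gcongr
    have e : 156 / z ^ 14 - 84 / z ^ 8 = (156 / z ^ 6 - 84) / z ^ 8 := by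
      field_simp
    have h156 : 156 / (2 * 1.0771) ^ 6 ≤ 156 / z ^ 6 := by gcongr
    rw [e]
    constructor
    · rw [le_div_iff₀ (by positivity)]
      norm_num at h156 l8 ⊢
      linarith
    · refine div_nonpos_of_nonpos_of_nonneg ?_ (by positivity)
      rw [sub_nonpos, div_le_iff₀ (by positivity)]
      norm_num at l6 ⊢
      linarith
  have softlt : ∀ x ∈ Set.Icc (2 * 0.9706 : ℝ) (2 * 1.0771),
      ∀ y ∈ Set.Icc (2 * 0.9706 : ℝ) (2 * 1.0771), x < y →
      η y ≤ η x ∧ η x - η y ≤ 0.41 * (y - x) := by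
    intro x hx y hy hxy
    obtain ⟨z, hz, h⟩ := mvt x y (by linarith [hx.1]) hxy
    obtain ⟨s1, s2⟩ := soft z (hx.1.trans hz.1.le) (hz.2.le.trans hy.2)
    constructor <;> nlinarith
  refine ⟨?_, ?_, ?_, ?_, ?_⟩
  · have hlt : ∀ x ∈ Set.Icc (0.9706 : ℝ) 1.0771, ∀ y ∈ Set.Icc (0.9706 : ℝ) 1.0771, x < y →
        ∃ t, (8.7 : ℝ) ≤ t ∧ t ≤ 300 ∧ η y - η x = t * (y - x) := by
      intro x hx y hy hxy
      obtain ⟨z, hz, h⟩ := mvt x y (by linarith [hx.1]) hxy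
      obtain ⟨s1, s2⟩ := stiff z (hx.1.trans hz.1.le) (hz.2.le.trans hy.2)
      exact ⟨_, s1, s2, h⟩
    intro x hx y hy
    rcases lt_trichotomy x y with h | rfl | h
    · obtain ⟨t, h1, h2, h3⟩ := hlt x hx y hy h
      exact ⟨t, h1, h2, by linear_combination -h3⟩
    · exact ⟨300, by norm_num, le_rfl, by simp⟩
    · exact hlt y hy x hx h
  · intro x hx y hy
    rcases lt_trichotomy x y with h | rfl | h
    · obtain ⟨h1, h2⟩ := softlt x hx y hy h
      rw [abs_of_nonneg (by linarith), abs_of_neg (by linarith)]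
      linarith
    · simp
    · obtain ⟨h1, h2⟩ := softlt y hy x hx h
      rw [abs_of_nonpos (by linarith), abs_of_pos (by linarith)]
      linarith
  · intro x hx y hy hxy
    rcases hxy.eq_or_lt with rfl | h
    · exact le_rfl
    · exact (softlt x hx y hy h).1
  · rw [hη _ (by norm_num), hη _ (by norm_num)]; norm_num
  · rw [hη _ (by norm_num), hη _ (by norm_num)]; norm_num

theorem vcomp_sub (N : ℕ) (r : Fin (2*N+1) → ℝ) (i : Fin (2*N+1)) :
    vcomp N r ((i.val : ℤ) - N) = r i := by
  have := i.isLt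
  simp only [vcomp, sub_add_cancel, Int.toNat_natCast, this, dite_true]

theorem exists_vcomp_eq (N : ℕ) {u : ℤ} (h1 : -(N:ℤ) ≤ u) (h2 : u ≤ N) :
    ∃ k : Fin (2*N+1), (k.val : ℤ) - N = u ∧ ∀ r : Fin (2*N+1) → ℝ, vcomp N r u = r k := by
  have h : (u + N).toNat < 2*N+1 := by omega
  exact ⟨⟨(u + N).toNat, h⟩, by simp only; omega, fun r => by simp [vcomp, h]⟩

theorem vcomp_neg_of_symVec {N : ℕ} {r : Fin (2*N+1) → ℝ} (hr : SymVec N r) {u v : ℤ}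
    (h1 : -(N:ℤ) ≤ u) (h2 : u ≤ N) (h : v = -u) : vcomp N r v = vcomp N r u := by
  subst h
  rcases lt_trichotomy u 0 with h | rfl | h
  · simpa using (hr (-u) (by omega) (by omega)).symm
  · simp
  · exact hr u (by omega) h2

theorem rev_val_sub (N : ℕ) (i : Fin (2*N+1)) :
    ((Fin.rev i).val : ℤ) - N = -((i.val : ℤ) - N) := by
  have := i.isLt
  rw [Fin.val_rev]
  omega

theorem symVec_iff_rev (N : ℕ) (r : Fin (2*N+1) → ℝ) :
    SymVec N r ↔ ∀ k, r (Fin.rev k) = r k := by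
  constructor
  · intro h k
    have := k.isLt
    rw [← vcomp_sub N r (Fin.rev k), ← vcomp_sub N r k]
    exact vcomp_neg_of_symVec h (by omega) (by omega) (rev_val_sub N k)
  · intro h j h1 h2
    obtain ⟨k, hk, hkr⟩ := exists_vcomp_eq N (u := j) (by omega) h2
    rw [← hk, ← rev_val_sub, vcomp_sub, vcomp_sub, h]

/-- Near-diagonal estimate for the increments of one ghost-force iteration step. -/
theorem PairForceBounds.ghostForceStep_increment {N K : ℕ} (hK : 2 ≤ K) (hKN : K + 2 ≤ N)
    {η : ℝ → ℝ} {a b A : ℝ} (hη : PairForceBounds η a b A) {r s q p : Fin (2*N+1) → ℝ}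
    (hr : ∀ k, r k ∈ Set.Icc a b) (hs : ∀ k, s k ∈ Set.Icc a b)
    (hq : ∀ k, q k ∈ Set.Icc a b) (hp : ∀ k, p k ∈ Set.Icc a b) {L : ℝ}
    (hrs : ∀ k, |r k - s k| ≤ L) (hqp : ∀ k, |q k - p k| ≤ 2 * L) (i : Fin (2*N+1)) :
    ∃ t, (8.7 : ℝ) ≤ t ∧ t ≤ A ∧
      |(PsiE N K η r i + PsiG N K η q i) - (PsiE N K η s i + PsiG N K η p i) - t * (r i - s i)|
        ≤ 8.61 * L := by
  obtain ⟨t, ht1, ht2, ht⟩ := hη.stiff _ (hr i) _ (hs i)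
  refine ⟨t, ht1, ht2, ?_⟩
  rw [← ht]
  have hL : 0 ≤ L := (abs_nonneg _).trans (hrs i)
  have pair : ∀ {x y : Fin (2*N+1) → ℝ}, (∀ k, x k ∈ Set.Icc a b) → (∀ k, y k ∈ Set.Icc a b) →
      ∀ {M : ℝ}, (∀ k, |x k - y k| ≤ M) → ∀ u v : ℤ, -(N:ℤ) ≤ u → u ≤ N → -(N:ℤ) ≤ v → v ≤ N →
      |η (vcomp N x u + vcomp N x v) - η (vcomp N y u + vcomp N y v)| ≤ 0.82 * M := by
    intro x y hx hy M hM u v hu1 hu2 hv1 hv2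
    obtain ⟨k, -, hk⟩ := exists_vcomp_eq N hu1 hu2
    obtain ⟨l, -, hl⟩ := exists_vcomp_eq N hv1 hv2
    simp only [hk, hl]
    have h := hη.soft (x k + x l) ⟨by linarith [(hx k).1, (hx l).1], by linarith [(hx k).2, (hx l).2]⟩
      (y k + y l) ⟨by linarith [(hy k).1, (hy l).1], by linarith [(hy k).2, (hy l).2]⟩
    have h2 : |x k + x l - (y k + y l)| ≤ |x k - y k| + |x l - y l| := by
      rw [add_sub_add_comm]; exact abs_add_le _ _
    linarith [hM k, hM l]
  have pairE := pair hr hs hrs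
  have pairG := pair hq hp hqp
  have dblE : ∀ u : ℤ, -(N:ℤ) ≤ u → u ≤ N →
      |η (2 * vcomp N r u) - η (2 * vcomp N s u)| ≤ 0.82 * L := by
    intro u h1 h2; simpa only [two_mul] using pairE u u h1 h2 h1 h2
  have dblG : ∀ u : ℤ, -(N:ℤ) ≤ u → u ≤ N →
      |η (2 * vcomp N q u) - η (2 * vcomp N p u)| ≤ 0.82 * (2 * L) := by
    intro u h1 h2
    have := pairG u u h1 h2 h1 h2
    rwa [← two_mul, ← two_mul] at this
  simp only [abs_le] at pairE pairG dblE dblG ⊢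
  rw [← vcomp_sub N r i, ← vcomp_sub N s i]
  have hi := i.isLt
  simp only [PsiG, PsiF, PsiE]
  generalize hj : (i.val : ℤ) - (N : ℤ) = j
  have hj1 : -(N:ℤ) ≤ j := by omega
  have hj2 : j ≤ N := by omega
  have C1 := dblG K (by omega) (by omega)
  have C2 := pairG K (K-1) (by omega) (by omega) (by omega) (by omega)
  have C3 := pairG K (K+1) (by omega) (by omega) (by omega) (by omega)
  have E0 := dblE j hj1 hj2
  have G0 := dblG j hj1 hj2
  by_cases hout : j < -(K:ℤ) - 1 ∨ (K:ℤ) + 1 < j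
  · simp only [show ¬ (-(K:ℤ)+1 ≤ j ∧ j ≤ (K:ℤ)-1) by omega, show ¬ j = -(K:ℤ)-1 by omega,
      show ¬ j = (K:ℤ)+1 by omega, show ¬ (j = -(K:ℤ) ∨ j = (K:ℤ)) by omega,
      show ¬ j = -(K:ℤ)+1 by omega, show ¬ j = (K:ℤ)-1 by omega,
      show ¬ (-(K:ℤ)+2 ≤ j ∧ j ≤ (K:ℤ)-2) by omega, if_false]
    constructor <;> linarith
  have E1 := pairE j (j-1) hj1 hj2 (by omega) (by omega)
  have E2 := pairE j (j+1) hj1 hj2 (by omega) (by omega)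
  have E3 := pairE (j-1) j (by omega) (by omega) hj1 hj2
  have G1 := pairG j (j-1) hj1 hj2 (by omega) (by omega)
  have G2 := pairG j (j+1) hj1 hj2 (by omega) (by omega)
  have G3 := pairG (j-1) j (by omega) (by omega) hj1 hj2
  split_ifs <;> first | omega | (constructor <;> linarith)

/-- One ghost-force iteration step points outward at the faces of the box. -/
theorem PairForceBounds.ghostForceStep_boundary {N K : ℕ} (hK : 2 ≤ K) (hKN : K + 2 ≤ N)
    {η : ℝ → ℝ} {a b A : ℝ} (hη : PairForceBounds η a b A) (hab : a ≤ b) (hba : b - a ≤ 0.1065)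
    {r q : Fin (2*N+1) → ℝ}
    (hr : ∀ k, r k ∈ Set.Icc a b) (hq : ∀ k, q k ∈ Set.Icc a b) (i : Fin (2*N+1)) :
    (r i = a → PsiE N K η r i + PsiG N K η q i ≤ -2.56) ∧
      (r i = b → 2.56 ≤ PsiE N K η r i + PsiG N K η q i) := by
  have vc : ∀ {x : Fin (2*N+1) → ℝ}, (∀ k, x k ∈ Set.Icc a b) → ∀ u : ℤ, -(N:ℤ) ≤ u → u ≤ N →
      vcomp N x u ∈ Set.Icc a b := by
    intro x hx u h1 h2
    obtain ⟨k, -, hk⟩ := exists_vcomp_eq N h1 h2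
    rw [hk]; exact hx k
  have rng : ∀ x ∈ Set.Icc a b, ∀ y ∈ Set.Icc a b, x + y ∈ Set.Icc (2 * a) (2 * b) :=
    fun x hx y hy => ⟨by linarith [hx.1, hy.1], by linarith [hx.2, hy.2]⟩
  have ends : 2 * a ∈ Set.Icc (2 * a) (2 * b) ∧ 2 * b ∈ Set.Icc (2 * a) (2 * b) :=
    ⟨⟨le_rfl, by linarith⟩, ⟨by linarith, le_rfl⟩⟩
  have bd : ∀ {x : Fin (2*N+1) → ℝ}, (∀ k, x k ∈ Set.Icc a b) →
      ∀ u v : ℤ, -(N:ℤ) ≤ u → u ≤ N → -(N:ℤ) ≤ v → v ≤ N →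
      η (2 * b) ≤ η (vcomp N x u + vcomp N x v) ∧ η (vcomp N x u + vcomp N x v) ≤ η (2 * a) := by
    intro x hx u v hu1 hu2 hv1 hv2
    have h := rng _ (vc hx u hu1 hu2) _ (vc hx v hv1 hv2)
    exact ⟨hη.anti h ends.2 h.2, hη.anti ends.1 h h.1⟩
  have dif : ∀ u v : ℤ, -(N:ℤ) ≤ u → u ≤ N → -(N:ℤ) ≤ v → v ≤ N →
      |η (2 * vcomp N q u) - η (vcomp N q u + vcomp N q v)| ≤ 0.41 * 0.1065 := by
    intro u v hu1 hu2 hv1 hv2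
    have hu := vc hq u hu1 hu2
    have hv := vc hq v hv1 hv2
    rw [two_mul]
    refine (hη.soft _ (rng _ hu _ hu) _ (rng _ hu _ hv)).trans ?_
    gcongr
    rw [abs_le]
    constructor <;> linarith [hu.1, hu.2, hv.1, hv.2]
  have wid : η (2 * a) - η (2 * b) ≤ 0.41 * (2 * 0.1065) := by
    refine (le_abs_self _).trans ((hη.soft _ ends.1 _ ends.2).trans ?_)
    gcongr
    rw [abs_le]
    constructor <;> linarith
  simp only [abs_le] at dif
  have lower := hη.lower
  have upper := hη.upper
  rw [← vcomp_sub N r i]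
  have hi := i.isLt
  have bdr := bd hr
  have bdq := bd hq
  simp only [PsiG, PsiF, PsiE]
  generalize hj : (i.val : ℤ) - (N : ℤ) = j
  have hj1 : -(N:ℤ) ≤ j := by omega
  have hj2 : j ≤ N := by omega
  have C2 := dif K (K-1) (by omega) (by omega) (by omega) (by omega)
  have C3 := dif K (K+1) (by omega) (by omega) (by omega) (by omega)
  by_cases hout : j < -(K:ℤ) - 1 ∨ (K:ℤ) + 1 < j
  · simp only [show ¬ (-(K:ℤ)+1 ≤ j ∧ j ≤ (K:ℤ)-1) by omega, show ¬ j = -(K:ℤ)-1 by omega,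
      show ¬ j = (K:ℤ)+1 by omega, show ¬ (j = -(K:ℤ) ∨ j = (K:ℤ)) by omega,
      show ¬ j = -(K:ℤ)+1 by omega, show ¬ j = (K:ℤ)-1 by omega,
      show ¬ (-(K:ℤ)+2 ≤ j ∧ j ≤ (K:ℤ)-2) by omega, if_false]
    constructor <;> (intro h; rw [h]; linarith)
  have D1 := dif j (j-1) hj1 hj2 (by omega) (by omega)
  have D2 := dif j (j+1) hj1 hj2 (by omega) (by omega)
  have E1 := bdr j (j-1) hj1 hj2 (by omega) (by omega)
  have E2 := bdr j (j+1) hj1 hj2 (by omega) (by omega)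
  have E3 := bdr (j-1) j (by omega) (by omega) hj1 hj2
  have G1 := bdq j (j-1) hj1 hj2 (by omega) (by omega)
  have G2 := bdq j (j+1) hj1 hj2 (by omega) (by omega)
  have G3 := bdq (j-1) j (by omega) (by omega) hj1 hj2
  constructor <;> intro h <;> rw [h] at E1 E2 E3 ⊢ <;> split_ifs <;> first | omega | linarith

set_option maxHeartbeats 1000000 in
theorem PsiE_rev {N K : ℕ} (hK : 2 ≤ K) (hKN : K + 2 ≤ N) (η : ℝ → ℝ) {r : Fin (2*N+1) → ℝ}
    (hr : SymVec N r) (i : Fin (2*N+1)) : PsiE N K η r (Fin.rev i) = PsiE N K η r i := by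
  have hi := i.isLt
  simp only [PsiE, rev_val_sub]
  generalize hj : (i.val : ℤ) - (N : ℤ) = j
  have h0 := vcomp_neg_of_symVec hr (u := j) (v := -j) (by omega) (by omega) rfl
  by_cases hout : j < -(K:ℤ) - 1 ∨ (K:ℤ) + 1 < j
  · rw [h0]
    split_ifs <;> first | omega | rfl
  have h1 := vcomp_neg_of_symVec hr (u := j + 1) (v := -j - 1) (by omega) (by omega) (by ring)
  have h2 := vcomp_neg_of_symVec hr (u := j - 1) (v := -j + 1) (by omega) (by omega) (by ring)
  rw [h0, h1, h2, add_comm (vcomp N r (j - 1)), add_comm (vcomp N r (j + 1))]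
  split_ifs <;> first | omega | ring

theorem PsiF_rev {N K : ℕ} (hKN : K + 2 ≤ N) (η : ℝ → ℝ) {r : Fin (2*N+1) → ℝ}
    (hr : SymVec N r) (i : Fin (2*N+1)) : PsiF N K η r (Fin.rev i) = PsiF N K η r i := by
  have hi := i.isLt
  simp only [PsiF, rev_val_sub]
  generalize hj : (i.val : ℤ) - (N : ℤ) = j
  have h0 := vcomp_neg_of_symVec hr (u := j) (v := -j) (by omega) (by omega) rfl
  by_cases hout : j < -(K:ℤ) - 1 ∨ (K:ℤ) + 1 < j
  · rw [h0]
    split_ifs <;> first | omega | rfl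
  have h1 := vcomp_neg_of_symVec hr (u := j + 1) (v := -j - 1) (by omega) (by omega) (by ring)
  have h2 := vcomp_neg_of_symVec hr (u := j - 1) (v := -j + 1) (by omega) (by omega) (by ring)
  rw [h0, h1, h2]
  split_ifs <;> first | omega | ring

theorem sum_Icc_sub_one_add (f : ℤ → ℝ) {m j : ℤ} (h : m ≤ j) :
    ∑ i ∈ Finset.Icc m j, f i = ∑ i ∈ Finset.Icc m (j - 1), f i + f j := by
  have : Finset.Icc m j = insert j (Finset.Icc m (j - 1)) := by
    ext x; simp only [Finset.mem_insert, Finset.mem_Icc]; omega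
  rw [this, Finset.sum_insert (by simp), add_comm]

/-- Partial sums of forces that are anti-symmetric about `1/2` are symmetric about `0`. -/
theorem sum_Icc_neg_of_antisymm {N : ℕ} {f : ℤ → ℝ}
    (hanti : ∀ j : ℤ, 0 ≤ j → j ≤ (N:ℤ) → f (j+1) = - f (-j)) (j : ℕ) (hj : j ≤ N) :
    ∑ i ∈ Finset.Icc (-(N:ℤ)) (-(j:ℤ)), f i = ∑ i ∈ Finset.Icc (-(N:ℤ)) (j:ℤ), f i := by
  induction j with
  | zero => simp
  | succ j ih =>
    have h1 := ih (by omega)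
    have h2 := sum_Icc_sub_one_add f (m := -(N:ℤ)) (j := -(j:ℤ)) (by omega)
    have h3 := sum_Icc_sub_one_add f (m := -(N:ℤ)) (j := (j:ℤ) + 1) (by omega)
    have h4 := hanti j (by omega) (by omega)
    rw [add_sub_cancel_right] at h3
    push_cast
    rw [neg_add, ← sub_eq_add_neg]
    linarith

/-- For symmetric vectors, the force-based equilibrium equations are the conjugate-force
equations `Ψ̂^F(r) = Φ`. -/
theorem forall_FQCFr_iff_PsiF_eq {N K : ℕ} (hK : 2 ≤ K) (hKN : K + 2 ≤ N) (η : ℝ → ℝ)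
    {f : ℤ → ℝ} (hsum : ∑ j ∈ Finset.Icc (-(N:ℤ)) ((N:ℤ)+1), f j = 0)
    {Φ : Fin (2*N+1) → ℝ}
    (hΦ : ∀ i : Fin (2*N+1), Φ i = -(∑ i' ∈ Finset.Icc (-(N:ℤ)) ((i.val:ℤ) - (N:ℤ)), f i'))
    {r : Fin (2*N+1) → ℝ} (hr : SymVec N r) :
    (∀ j : ℤ, -(N:ℤ) ≤ j → j ≤ (N:ℤ)+1 → FQCFr N K η (vcomp N r) j + f j = 0) ↔
      ∀ i, PsiF N K η r i = Φ i := by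
  obtain ⟨ψ, hψ⟩ : ∃ ψ : ℤ → ℝ, ψ = fun j => if -(K:ℤ)+1 ≤ j ∧ j ≤ (K:ℤ)-1 then
      η (vcomp N r j) + η (vcomp N r j + vcomp N r (j-1)) + η (vcomp N r j + vcomp N r (j+1))
        + 2 * η (2 * vcomp N r (K:ℤ)) - η (vcomp N r (K:ℤ) + vcomp N r ((K:ℤ)-1))
        - η (vcomp N r (K:ℤ) + vcomp N r ((K:ℤ)+1))
    else η (vcomp N r j) + 2 * η (2 * vcomp N r j) := ⟨_, rfl⟩
  have hPsi : ∀ i : Fin (2*N+1), PsiF N K η r i = ψ ((i.val : ℤ) - N) := by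
    intro i; rw [hψ]; rfl
  have hfirst : FQCFr N K η (vcomp N r) (-(N:ℤ)) = ψ (-(N:ℤ)) := by
    simp only [FQCFr, hψ, if_true, show ¬ (-(K:ℤ)+1 ≤ -(N:ℤ) ∧ -(N:ℤ) ≤ (K:ℤ)-1) by omega, if_false]
  have hlast : FQCFr N K η (vcomp N r) ((N:ℤ)+1) = -ψ N := by
    simp only [FQCFr, hψ, if_true, show ¬ (N:ℤ)+1 = -(N:ℤ) by omega,
      show ¬ (-(K:ℤ)+1 ≤ (N:ℤ) ∧ (N:ℤ) ≤ (K:ℤ)-1) by omega, if_false, add_sub_cancel_right]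
  have hmid : ∀ j : ℤ, -(N:ℤ) < j → j ≤ N → FQCFr N K η (vcomp N r) j = ψ j - ψ (j-1) := by
    intro j h1 h2
    simp only [FQCFr, hψ, sub_add_cancel, show j - 1 - 1 = j - 2 by ring]
    rcases eq_or_ne j (-(K:ℤ)+1) with rfl | hjl
    · have e0 := vcomp_neg_of_symVec hr (u := K) (v := -(K:ℤ)+1-1) (by omega) (by omega) (by ring)
      have e1 := vcomp_neg_of_symVec hr (u := K-1) (v := -(K:ℤ)+1) (by omega) (by omega) (by ring)
      have e2 := vcomp_neg_of_symVec hr (u := K+1) (v := -(K:ℤ)+1-2) (by omega) (by omega) (by ring)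
      rw [e0, e1, e2, add_comm (vcomp N r ((K:ℤ) - 1)) (vcomp N r K)]
      split_ifs <;> first | omega | ring
    rcases eq_or_ne j (K:ℤ) with rfl | hjr
    · rw [add_comm (vcomp N r ((K:ℤ) - 1)) (vcomp N r K)]
      split_ifs <;> first | omega | ring
    · rw [add_comm (vcomp N r (j - 1)) (vcomp N r j)]
      split_ifs <;> first | omega | ring
  have hempty : ∑ i ∈ Finset.Icc (-(N:ℤ)) (-(N:ℤ) - 1), f i = 0 := by simp
  have hstep := fun j h => sum_Icc_sub_one_add f (m := -(N:ℤ)) (j := j) h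
  have hstep0 := hstep (-(N:ℤ)) le_rfl
  constructor
  · intro h
    have hall : ∀ j : ℤ, -(N:ℤ) ≤ j → j ≤ N → ψ j = -∑ i ∈ Finset.Icc (-(N:ℤ)) j, f i := by
      intro j hj
      induction j, hj using Int.leInduction with
      | base =>
        intro _
        have := h (-(N:ℤ)) le_rfl (by omega)
        linarith
      | succ j hj ih =>
        intro hjN
        have h1 := ih (by omega)
        have h2 := h (j+1) (by omega) (by omega)
        have h3 := hstep (j+1) (by omega)
        rw [hmid (j+1) (by omega) hjN] at h2
        rw [add_sub_cancel_right] at h2 h3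
        linarith
    intro i
    have hi := i.isLt
    rw [hPsi, hΦ, hall _ (by omega) (by omega)]
  · intro h
    have hall : ∀ j : ℤ, -(N:ℤ) ≤ j → j ≤ N → ψ j = -∑ i ∈ Finset.Icc (-(N:ℤ)) j, f i := by
      intro j h1 h2
      obtain ⟨k, hk, -⟩ := exists_vcomp_eq N h1 h2
      rw [← hk, ← hPsi, ← hΦ, h]
    intro j h1 h2
    rcases h1.eq_or_lt with rfl | h1'
    · have := hall _ le_rfl (by omega)
      linarith
    rcases h2.eq_or_lt with rfl | h2'
    · have h3 := hstep ((N:ℤ)+1) h1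
      rw [add_sub_cancel_right] at h3
      have := hall N (by omega) le_rfl
      linarith
    · rw [hmid j h1' (by omega), hall j h1 (by omega), hall (j-1) (by omega) (by omega), hstep j h1]
      ring

/-- The ghost-force iteration contracts distances by a factor `1/2` in the maximum norm. -/
theorem PairForceBounds.ghostForceStep_contraction {N K : ℕ} (hK : 2 ≤ K) (hKN : K + 2 ≤ N)
    {η : ℝ → ℝ} {a b A : ℝ} (hη : PairForceBounds η a b A) {r s q p Φ : Fin (2*N+1) → ℝ}
    (hr : ∀ k, r k ∈ Set.Icc a b) (hs : ∀ k, s k ∈ Set.Icc a b)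
    (hq : ∀ k, q k ∈ Set.Icc a b) (hp : ∀ k, p k ∈ Set.Icc a b)
    (hrq : ∀ i, PsiE N K η r i + PsiG N K η q i = Φ i)
    (hsp : ∀ i, PsiE N K η s i + PsiG N K η p i = Φ i) :
    ‖r - s‖ ≤ (1/2) * ‖q - p‖ := by
  by_contra! hlt
  have hpos : 0 < ‖r - s‖ := lt_of_le_of_lt (by positivity) hlt
  have hle : ‖r - s‖ ≤ 8.61 / 8.7 * ‖r - s‖ := by
    refine (pi_norm_le_iff_of_nonneg (by positivity)).2 fun i => ?_
    obtain ⟨t, ht, -, h⟩ := hη.ghostForceStep_increment hK hKN hr hs hq hp (L := ‖r - s‖)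
      (fun k => norm_le_pi_norm (r - s) k)
      (fun k => (norm_le_pi_norm (q - p) k).trans (by linarith)) i
    rw [hrq, hsp, sub_self, zero_sub, abs_neg, abs_mul, abs_of_pos (by linarith)] at h
    have h2 : 8.7 * |r i - s i| ≤ t * |r i - s i| := by gcongr
    rw [Pi.sub_apply, Real.norm_eq_abs]
    linarith
  linarith

/-- Explicit ghost force iteration region for the Lennard-Jones potential: with
`r_L = 0.9706`, `r_U = 1.0771` and anti-symmetric external forces with `-2.56 < Φ_j < 2.56`,
each ghost-force iteration step maps a symmetric vector in `Ω` to a unique symmetric vector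
in `Ω`, the induced map is a contraction with constant at most `1/2` in the max norm, and in
particular `‖rⁿ⁺¹ - r‖ ≤ (1/2)‖rⁿ - r‖` where `r` is the unique symmetric solution in `Ω`
of the force-based quasicontinuum equilibrium equations. -/
theorem lennardJones_ghost_force_iteration
    (N K : ℕ) (hK : 2 ≤ K) (hKN : K + 2 ≤ N)
    (φ : ℝ → ℝ) (hφ : φ = fun r => 1/r^12 - 2/r^6)
    (η : ℝ → ℝ) (hη : η = deriv φ)
    (rL rU : ℝ) (hrL : rL = (0.9706:ℝ)) (hrU : rU = (1.0771:ℝ))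
    (f : ℤ → ℝ)
    (hsum : ∑ j ∈ Finset.Icc (-(N:ℤ)) ((N:ℤ)+1), f j = 0)
    (hanti : ∀ j : ℤ, 0 ≤ j → j ≤ (N:ℤ) → f (j+1) = - f (-j))
    (Φ : Fin (2*N+1) → ℝ)
    (hΦdef : ∀ i : Fin (2*N+1), Φ i = -(∑ i' ∈ Finset.Icc (-(N:ℤ)) ((i.val:ℤ) - (N:ℤ)), f i'))
    (hΦ : ∀ i, -(2.56:ℝ) < Φ i ∧ Φ i < (2.56:ℝ)) :
    ∃ rs : Fin (2*N+1) → ℝ,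
      ((∀ k, rs k ∈ Ioo rL rU) ∧ SymVec N rs ∧
        (∀ j : ℤ, -(N:ℤ) ≤ j → j ≤ (N:ℤ)+1 → FQCFr N K η (vcomp N rs) j + f j = 0)) ∧
      (∀ r' : Fin (2*N+1) → ℝ, ((∀ k, r' k ∈ Ioo rL rU) ∧ SymVec N r' ∧
        (∀ j : ℤ, -(N:ℤ) ≤ j → j ≤ (N:ℤ)+1 → FQCFr N K η (vcomp N r') j + f j = 0)) →
        r' = rs) ∧
      (∀ rn : Fin (2*N+1) → ℝ, (∀ k, rn k ∈ Ioo rL rU) → SymVec N rn →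
        ∃! rn1 : Fin (2*N+1) → ℝ, (∀ k, rn1 k ∈ Ioo rL rU) ∧ SymVec N rn1 ∧
          (∀ i, PsiE N K η rn1 i + PsiG N K η rn i = Φ i)) ∧
      (∀ rn sn rn1 sn1 : Fin (2*N+1) → ℝ,
        (∀ k, rn k ∈ Ioo rL rU) → SymVec N rn → (∀ k, sn k ∈ Ioo rL rU) → SymVec N sn →
        (∀ k, rn1 k ∈ Ioo rL rU) → SymVec N rn1 → (∀ k, sn1 k ∈ Ioo rL rU) → SymVec N sn1 →
        (∀ i, PsiE N K η rn1 i + PsiG N K η rn i = Φ i) →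
        (∀ i, PsiE N K η sn1 i + PsiG N K η sn i = Φ i) →
        ‖rn1 - sn1‖ ≤ (1/2) * ‖rn - sn‖) ∧
      (∀ rn rn1 : Fin (2*N+1) → ℝ,
        (∀ k, rn k ∈ Ioo rL rU) → SymVec N rn →
        (∀ k, rn1 k ∈ Ioo rL rU) → SymVec N rn1 →
        (∀ i, PsiE N K η rn1 i + PsiG N K η rn i = Φ i) →
        ‖rn1 - rs‖ ≤ (1/2) * ‖rn - rs‖) := by
  have hη' : PairForceBounds η rL rU 300 := by
    rw [hη, hφ, hrL, hrU]; exact pairForceBounds_lennardJones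
  have hab : rL ≤ rU := by rw [hrL, hrU]; norm_num
  have hba : rU - rL ≤ 0.1065 := by rw [hrL, hrU]; norm_num
  have hcl : ∀ {r : Fin (2*N+1) → ℝ}, (∀ k, r k ∈ Set.Ioo rL rU) → ∀ k, r k ∈ Set.Icc rL rU :=
    fun h k => Set.Ioo_subset_Icc_self (h k)
  have hΦsym : ∀ k, Φ (Fin.rev k) = Φ k := by
    intro k
    have hk := k.isLt
    rw [hΦdef, hΦdef, rev_val_sub]
    obtain ⟨m, hm | hm⟩ := Int.eq_nat_or_neg ((k.val : ℤ) - N)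
    · rw [hm, sum_Icc_neg_of_antisymm hanti m (by omega)]
    · rw [hm, neg_neg, sum_Icc_neg_of_antisymm hanti m (by omega)]
  have hEG : ∀ r i, PsiE N K η r i + PsiG N K η r i = PsiF N K η r i :=
    fun r i => by simp only [PsiG]; ring
  -- `q` selects the argument of the ghost-force correction: the identity gives `Ψ̂^F`, and a
  -- constant map gives one iteration step.
  have solve : ∀ q : (Fin (2*N+1) → ℝ) → Fin (2*N+1) → ℝ,
      (∀ r, (∀ k, r k ∈ Set.Icc rL rU) → ∀ k, q r k ∈ Set.Icc rL rU) →
      (∀ r, SymVec N r → SymVec N (q r)) →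
      (∀ r s L, (∀ k, |r k - s k| ≤ L) → ∀ k, |q r k - q s k| ≤ 2 * L) →
      ∃ r : Fin (2*N+1) → ℝ, (∀ k, r k ∈ Set.Ioo rL rU) ∧ SymVec N r ∧
        ∀ i, PsiE N K η r i + PsiG N K η (q r) i = Φ i := by
    intro q hq hqs hqL
    have hzero : ∃ r : Fin (2*N+1) → ℝ, (∀ k, r k ∈ Set.Ioo rL rU) ∧ (∀ k, r (Fin.rev k) = r k) ∧
        ∀ i, PsiE N K η r i + PsiG N K η (q r) i - Φ i = 0 := by
      refine exists_invariant_zero_of_diagonally_dominant Fin.rev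
        (fun r i => PsiE N K η r i + PsiG N K η (q r) i - Φ i) (α := 8.7) (A := 300) (β := 8.61)
        hab (by norm_num) (by norm_num) (by norm_num) ?_ ?_ ?_ ?_
      · intro r s hr hs L hL i
        simpa only [sub_sub_sub_cancel_right] using
          hη'.ghostForceStep_increment hK hKN hr hs (hq r hr) (hq s hs) hL (hqL r s L hL) i
      · intro r hr i hi
        linarith [(hη'.ghostForceStep_boundary hK hKN hab hba hr (hq r hr) i).1 hi, (hΦ i).1]
      · intro r hr i hi
        linarith [(hη'.ghostForceStep_boundary hK hKN hab hba hr (hq r hr) i).2 hi, (hΦ i).2]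
      · intro r hr hsym k
        have hs := (symVec_iff_rev N r).2 hsym
        simp only [PsiG, PsiE_rev hK hKN η hs, PsiE_rev hK hKN η (hqs r hs), PsiF_rev hKN η (hqs r hs),
          hΦsym]
    obtain ⟨r, h1, h2, h3⟩ := hzero
    exact ⟨r, h1, (symVec_iff_rev N r).2 h2, fun i => sub_eq_zero.1 (h3 i)⟩
  obtain ⟨rs, hrs, hrsS, hrsE⟩ := solve (fun r => r) (fun _ h => h) (fun _ h => h)
    (fun r s L hL k => (hL k).trans (by linarith [(abs_nonneg _).trans (hL k)]))
  have hiff := fun {r} => forall_FQCFr_iff_PsiF_eq hK hKN η hsum hΦdef (r := r)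
  refine ⟨rs, ⟨hrs, hrsS, (hiff hrsS).2 fun i => (hEG rs i).symm.trans (hrsE i)⟩, ?_, ?_, ?_, ?_⟩
  · rintro r ⟨hr, hrS, hrF⟩
    have hrE : ∀ i, PsiE N K η r i + PsiG N K η r i = Φ i :=
      fun i => (hEG r i).trans ((hiff hrS).1 hrF i)
    have h := hη'.ghostForceStep_contraction hK hKN (hcl hr) (hcl hrs) (hcl hr) (hcl hrs) hrE hrsE
    exact sub_eq_zero.1 (norm_le_zero_iff.1 (by linarith))
  · intro rn hrn hrnS
    obtain ⟨r, hr, hrS, hrE⟩ := solve (fun _ => rn) (fun _ _ => hcl hrn) (fun _ _ => hrnS)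
      (fun r s L hL k => by simpa using (abs_nonneg _).trans (hL k))
    refine ⟨r, ⟨hr, hrS, hrE⟩, ?_⟩
    rintro s ⟨hs, -, hsE⟩
    have h := hη'.ghostForceStep_contraction hK hKN (hcl hs) (hcl hr) (hcl hrn) (hcl hrn) hsE hrE
    rw [sub_self, norm_zero, mul_zero] at h
    exact sub_eq_zero.1 (norm_le_zero_iff.1 h)
  · intro rn sn rn1 sn1 hrn _ hsn _ hrn1 _ hsn1 _ h1 h2
    exact hη'.ghostForceStep_contraction hK hKN (hcl hrn1) (hcl hsn1) (hcl hrn) (hcl hsn) h1 h2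
  · intro rn rn1 hrn _ hrn1 _ h1
    exact hη'.ghostForceStep_contraction hK hKN (hcl hrn1) (hcl hrs) (hcl hrn) (hcl hrs) h1 hrsE
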